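/- Fix n₀ ∈ ℕ. For every t ∈ ℤ_{>0}, the sum over all weakly decreasing sequences n₀ ≥ n₁ ≥ n₂ ≥ ⋯ ≥ 0 of natural numbers with only finitely many nonzero terms of the product ∏_{1 ≤ i < t} z^{n_i} q^{n_i²} [n_{i−1} choose n_i]_q · ∏_{j ≥ t} z^{n_j} q^{n_j²+n_j} [n_{j−1} choose n_j]_q (a well-defined formal power series in z and q, since all but finitely many factors equal 1 and the minimal q-degree of the summands tends to infinity) equals (1 − zq^{n₀+1} − z^t q^t (1 − q^{n₀})) / (zq;q)_{n₀+1}. Moreover, the analogous sum in which every factor is of the first kind z^{n_i} q^{n_i²} [n_{i−1} choose n_i]_q (the case t = ∞) equals (1 − zq^{n₀+1}) / (zq;q)_{n₀+1} = 1/(zq;q)_{n₀}. -/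

import Mathlib

noncomputable section

/-- The ring of formal power series `ℚ[[z,q]]`. -/
abbrev R2 : Type := MvPowerSeries (Fin 2) ℚ

/-- The coefficientwise (product) topology on `ℚ[[z,q]]`. -/
instance : TopologicalSpace R2 :=
  inferInstanceAs (TopologicalSpace ((Fin 2 →₀ ℕ) → ℚ))

/-- The variable `z`. -/
def Z : R2 := MvPowerSeries.X 0
/-- The variable `q`. -/
def Q : R2 := MvPowerSeries.X 1

/-- The q-Pochhammer symbol `(a;q)_n = ∏_{t=0}^{n-1} (1 - a q^t)`. -/
def poch (a : R2) (n : ℕ) : R2 := ∏ t ∈ Finset.range n, (1 - a * Q ^ t)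

/-- `(q;q)_n`. -/
def qp (n : ℕ) : R2 := poch Q n

/-- The Gaussian binomial coefficient `[n choose k]_q = (q;q)_n / ((q;q)_k (q;q)_{n-k})`
for `0 ≤ k ≤ n`, and `0` otherwise. -/
def gbinom (n k : ℕ) : R2 := if k ≤ n then qp n * (qp k * qp (n - k))⁻¹ else 0

/-- Weakly decreasing sequences `n₀ = f 0 ≥ f 1 ≥ f 2 ≥ ⋯ ≥ 0` of natural numbers
with only finitely many nonzero terms. -/
def DecSeq (n₀ : ℕ) : Type :=
  {f : ℕ → ℕ // f 0 = n₀ ∧ (∀ i j : ℕ, i ≤ j → f j ≤ f i) ∧ ∃ N, ∀ i, N ≤ i → f i = 0}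

instance : IsTopologicalRing R2 :=
  MvPowerSeries.WithPiTopology.instIsTopologicalRing (Fin 2) ℚ

instance : T3Space R2 :=
  inferInstanceAs (T3Space ((Fin 2 →₀ ℕ) → ℚ))

section QSeries

@[simp] lemma constantCoeff_Z : MvPowerSeries.constantCoeff Z = 0 :=
  MvPowerSeries.constantCoeff_X 0

@[simp] lemma constantCoeff_Q : MvPowerSeries.constantCoeff Q = 0 :=
  MvPowerSeries.constantCoeff_X 1

lemma constantCoeff_poch (a : R2) (ha : MvPowerSeries.constantCoeff a = 0) (n : ℕ) :
    MvPowerSeries.constantCoeff (poch a n) = 1 := by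
  simp [poch, map_prod, ha]

lemma poch_mul_inv {a : R2} (ha : MvPowerSeries.constantCoeff a = 0) (n : ℕ) :
    poch a n * (poch a n)⁻¹ = 1 :=
  MvPowerSeries.mul_inv_cancel _ (by simp [constantCoeff_poch a ha])

lemma isUnit_poch {a : R2} (ha : MvPowerSeries.constantCoeff a = 0) (n : ℕ) :
    IsUnit (poch a n) :=
  IsUnit.of_mul_eq_one _ (poch_mul_inv ha n)

lemma isUnit_qp (n : ℕ) : IsUnit (qp n) := isUnit_poch constantCoeff_Q n

lemma poch_zero (a : R2) : poch a 0 = 1 := by simp [poch]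

lemma poch_succ (a : R2) (n : ℕ) : poch a (n + 1) = poch a n * (1 - a * Q ^ n) :=
  Finset.prod_range_succ _ _

lemma poch_succ' (a : R2) (n : ℕ) : poch a (n + 1) = (1 - a) * poch (a * Q) n := by
  simp [poch, Finset.prod_range_succ', pow_succ', mul_assoc, mul_comm]

lemma poch_add (a : R2) (m n : ℕ) : poch a (m + n) = poch a m * poch (a * Q ^ m) n := by
  simp [poch, Finset.prod_range_add, pow_add, mul_assoc]

lemma qp_succ (n : ℕ) : qp (n + 1) = qp n * (1 - Q ^ (n + 1)) := by
  rw [qp, poch_succ, ← pow_succ', qp]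

lemma gbinom_add_mul (k l : ℕ) : gbinom (k + l) k * (qp k * qp l) = qp (k + l) := by
  have h : (qp k * qp l) * (qp k * qp l)⁻¹ = 1 := MvPowerSeries.mul_inv_cancel _ (by
    simp [qp, constantCoeff_poch])
  rw [gbinom, if_pos (Nat.le_add_right k l), Nat.add_sub_cancel_left]
  linear_combination qp (k + l) * h

lemma gbinom_of_lt {n k : ℕ} (h : n < k) : gbinom n k = 0 := if_neg (by omega)

lemma gbinom_zero_right (n : ℕ) : gbinom n 0 = 1 := by
  refine (isUnit_qp n).mul_right_cancel ?_
  simpa [qp, poch_zero] using gbinom_add_mul 0 n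

lemma gbinom_self (n : ℕ) : gbinom n n = 1 := by
  refine (isUnit_qp n).mul_right_cancel ?_
  simpa [qp, poch_zero] using gbinom_add_mul n 0

lemma gbinom_succ_succ (n k : ℕ) :
    gbinom (n + 1) (k + 1) = gbinom n k + Q ^ (k + 1) * gbinom n (k + 1) := by
  rcases lt_trichotomy n k with h | rfl | h
  · simp [gbinom_of_lt h, gbinom_of_lt (Nat.succ_lt_succ h), gbinom_of_lt (Nat.lt_succ_of_lt h)]
  · simp [gbinom_self, gbinom_of_lt (Nat.lt_succ_self n)]
  · obtain ⟨l, rfl⟩ := Nat.exists_eq_add_of_lt h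
    refine ((isUnit_qp (k + 1)).mul (isUnit_qp (l + 1))).mul_right_cancel ?_
    have h1 := gbinom_add_mul (k + 1) (l + 1)
    have h2 := gbinom_add_mul k (l + 1)
    have h3 := gbinom_add_mul (k + 1) l
    rw [show k + 1 + (l + 1) = k + l + 1 + 1 by ring, qp_succ (k + l + 1)] at h1
    rw [show k + (l + 1) = k + l + 1 by ring] at h2
    rw [show k + 1 + l = k + l + 1 by ring] at h3
    rw [h1, add_mul]
    rw [qp_succ l] at h2 ⊢
    rw [qp_succ k] at h3 ⊢
    linear_combination (-(1 - Q ^ (k + 1))) * h2 - Q ^ (k + 1) * (1 - Q ^ (l + 1)) * h3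

lemma gbinom_succ_succ_mul (n k : ℕ) :
    gbinom (n + 1) (k + 1) * (1 - Q ^ (k + 1)) = (1 - Q ^ (n + 1)) * gbinom n k := by
  rcases lt_or_ge n k with h | h
  · simp [gbinom_of_lt h, gbinom_of_lt (Nat.succ_lt_succ h)]
  · obtain ⟨l, rfl⟩ := Nat.exists_eq_add_of_le h
    refine ((isUnit_qp k).mul (isUnit_qp l)).mul_right_cancel ?_
    have h1 := gbinom_add_mul (k + 1) l
    rw [show k + 1 + l = k + l + 1 by ring, qp_succ, qp_succ] at h1
    linear_combination h1 - (1 - Q ^ (k + l + 1)) * gbinom_add_mul k l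

/-- The polynomial form of the finite Durfee square identity. -/
lemma sum_gbinom_mul_poch (n : ℕ) (a : R2) :
    ∑ m ∈ Finset.range (n + 1),
      a ^ m * Q ^ (m ^ 2) * gbinom n m * poch (a * Q ^ (m + 1)) (n - m) = 1 := by
  induction n generalizing a with
  | zero => simp [gbinom_self, poch_zero]
  | succ n ih =>
    have key : ∀ m ∈ Finset.range (n + 1),
        (a * Q) ^ m * Q ^ (m ^ 2) * gbinom n m * poch (a * Q ^ (m + 1)) (n + 1 - m)
          + a ^ (m + 1) * Q ^ ((m + 1) ^ 2) * gbinom n m * poch (a * Q ^ (m + 1 + 1)) (n - m)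
        = (a * Q) ^ m * Q ^ (m ^ 2) * gbinom n m * poch (a * Q * Q ^ (m + 1)) (n - m) := by
      intro m hm
      rw [Nat.succ_sub (Nat.lt_succ_iff.mp (Finset.mem_range.mp hm)), Nat.succ_eq_add_one,
        poch_succ', show a * Q ^ (m + 1) * Q = a * Q * Q ^ (m + 1) by ring,
        show a * Q ^ (m + 1 + 1) = a * Q * Q ^ (m + 1) by ring]
      ring
    rw [← ih (a * Q), ← Finset.sum_congr rfl key, Finset.sum_add_distrib, Finset.sum_range_succ',
      Finset.sum_range_succ' (fun m => (a * Q) ^ m * Q ^ (m ^ 2) * gbinom n m *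
        poch (a * Q ^ (m + 1)) (n + 1 - m)), add_right_comm, gbinom_zero_right, gbinom_zero_right]
    simp only [gbinom_succ_succ, Nat.add_sub_add_right]
    have : ∑ m ∈ Finset.range n, (a * Q) ^ (m + 1) * Q ^ ((m + 1) ^ 2) * gbinom n (m + 1) *
          poch (a * Q ^ (m + 1 + 1)) (n - m)
        = ∑ m ∈ Finset.range (n + 1), (a * Q) ^ (m + 1) * Q ^ ((m + 1) ^ 2) * gbinom n (m + 1) *
          poch (a * Q ^ (m + 1 + 1)) (n - m) := by
      rw [Finset.sum_range_succ _ n, gbinom_of_lt (Nat.lt_succ_self n)]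
      simp
    rw [this, ← Finset.sum_add_distrib]
    simp only [pow_zero]
    congr 1
    refine Finset.sum_congr rfl fun m _ => ?_
    ring

/-- The finite Durfee square identity. -/
lemma sum_gbinom_mul_inv_poch (n : ℕ) (a : R2) :
    ∑ m ∈ Finset.range (n + 1), a ^ m * Q ^ (m ^ 2) * gbinom n m * (poch (a * Q) m)⁻¹
      = (poch (a * Q) n)⁻¹ := by
  have ha : MvPowerSeries.constantCoeff (a * Q) = 0 := by simp
  refine (isUnit_poch ha n).mul_left_cancel ?_
  rw [poch_mul_inv ha, ← sum_gbinom_mul_poch n a, Finset.mul_sum]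
  refine Finset.sum_congr rfl fun m hm => ?_
  obtain ⟨l, rfl⟩ := Nat.exists_eq_add_of_le (Nat.lt_succ_iff.mp (Finset.mem_range.mp hm))
  rw [poch_add, Nat.add_sub_cancel_left, show a * Q * Q ^ m = a * Q ^ (m + 1) by ring]
  linear_combination (a ^ m * Q ^ (m ^ 2) * gbinom (m + l) m * poch (a * Q ^ (m + 1)) l) *
    poch_mul_inv ha m

lemma sum_gbinom_mul_one_sub_mul_inv_poch (n : ℕ) :
    ∑ m ∈ Finset.range (n + 1),
      Z ^ m * Q ^ (m ^ 2) * gbinom n m * ((1 - Q ^ m) * (poch (Z * Q) (m + 1))⁻¹)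
      = Z * Q * ((1 - Q ^ n) * (poch (Z * Q) (n + 1))⁻¹) := by
  cases n with
  | zero => simp
  | succ n =>
    have hinv : ∀ m, (poch (Z * Q) (m + 1 + 1))⁻¹ =
        (poch (Z * Q) 2)⁻¹ * (poch (Z * Q ^ 2 * Q) m)⁻¹ := by
      intro m
      rw [show m + 1 + 1 = 2 + m by ring, poch_add, MvPowerSeries.mul_inv_rev, mul_comm,
        show Z * Q * Q ^ 2 = Z * Q ^ 2 * Q by ring]
    rw [Finset.sum_range_succ', hinv, ← sum_gbinom_mul_inv_poch n (Z * Q ^ 2), Finset.mul_sum,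
      Finset.mul_sum, Finset.mul_sum, pow_zero Q, sub_self, zero_mul, mul_zero, add_zero]
    refine Finset.sum_congr rfl fun m _ => ?_
    rw [hinv]
    linear_combination (Z ^ (m + 1) * Q ^ ((m + 1) ^ 2) * (poch (Z * Q) 2)⁻¹ *
      (poch (Z * Q ^ 2 * Q) m)⁻¹) * gbinom_succ_succ_mul n m

/-- A solution of `G n = ∑ m ≤ n, c m * [n choose m] * G m` is determined by `G 0`. -/
lemma eq_of_gbinom_recursion {c G H : ℕ → R2} (hc : ∀ m, Z ^ m ∣ c m) (h0 : G 0 = H 0)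
    (hG : ∀ n, G n = ∑ m ∈ Finset.range (n + 1), c m * gbinom n m * G m)
    (hH : ∀ n, H n = ∑ m ∈ Finset.range (n + 1), c m * gbinom n m * H m) (n : ℕ) :
    G n = H n := by
  induction n using Nat.strong_induction_on with
  | _ n ih =>
    rcases n.eq_zero_or_pos with rfl | hn
    · exact h0
    have hu : IsUnit (1 - c n) := by
      obtain ⟨b, hb⟩ := hc n
      rw [MvPowerSeries.isUnit_iff_constantCoeff]
      simp [hb, hn.ne']
    refine hu.mul_left_cancel ?_
    have hs : ∑ m ∈ Finset.range n, c m * gbinom n m * G m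
        = ∑ m ∈ Finset.range n, c m * gbinom n m * H m :=
      Finset.sum_congr rfl fun m hm => by rw [ih m (Finset.mem_range.mp hm)]
    have h1 := hG n
    have h2 := hH n
    rw [Finset.sum_range_succ, gbinom_self] at h1 h2
    linear_combination h1 - h2 + hs

end QSeries

section ChainSum

/-- The product of `w i n_{i+1} * [n_i choose n_{i+1}]` along a sequence `f = (n_0, n_1, …)`. -/
def chainProd (w : ℕ → ℕ → R2) (f : ℕ → ℕ) : R2 :=
  ∏' i : ℕ, w i (f (i + 1)) * gbinom (f i) (f (i + 1))

/-- The underlying sequence of an element of `DecSeq n`. -/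
def DecSeq.seq {n : ℕ} (f : DecSeq n) : ℕ → ℕ := f.1

/-- The sum of `chainProd w` over all decreasing sequences starting at `n`. -/
def chainSum (w : ℕ → ℕ → R2) (n : ℕ) : R2 := ∑' f : DecSeq n, chainProd w f.seq

variable {w : ℕ → ℕ → R2}

lemma chainProd_eq_prod_range (hw0 : ∀ i, w i 0 = 1) {f : ℕ → ℕ} {N : ℕ}
    (hf : ∀ i, N ≤ i → f i = 0) :
    chainProd w f = ∏ i ∈ Finset.range N, w i (f (i + 1)) * gbinom (f i) (f (i + 1)) := by
  refine tprod_eq_prod fun i hi => ?_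
  rw [Finset.mem_range, not_lt] at hi
  rw [hf i hi, hf (i + 1) (by omega), hw0, gbinom_self, one_mul]

lemma chainProd_eq_mul_shift (hw0 : ∀ i, w i 0 = 1) {f : ℕ → ℕ} {N : ℕ}
    (hf : ∀ i, N ≤ i → f i = 0) :
    chainProd w f = w 0 (f 1) * gbinom (f 0) (f 1) *
      chainProd (fun i => w (i + 1)) (fun i => f (i + 1)) := by
  rw [chainProd_eq_prod_range hw0 (N := N + 1) fun i hi => hf i (by omega),
    chainProd_eq_prod_range (fun i => hw0 (i + 1)) (N := N) fun i hi => hf (i + 1) (by omega),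
    Finset.prod_range_succ', mul_comm]

lemma Z_pow_sum_dvd_chainProd (hw : ∀ i m, Z ^ m ∣ w i m) (hw0 : ∀ i, w i 0 = 1) {f : ℕ → ℕ}
    {N : ℕ} (hf : ∀ i, N ≤ i → f i = 0) (k : ℕ) :
    Z ^ (∑ i ∈ Finset.range k, f (i + 1)) ∣ chainProd w f := by
  rw [chainProd_eq_prod_range hw0 (N := max N k) fun i hi => hf i (by omega)]
  refine (pow_dvd_pow Z (Finset.sum_le_sum_of_subset
    (Finset.range_mono (le_max_right N k)))).trans ?_
  rw [← Finset.prod_pow_eq_pow_sum]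
  exact Finset.prod_dvd_prod_of_dvd _ _ fun i _ => (hw i _).mul_right _

lemma finite_setOf_decSeq_eq_zero (n d : ℕ) :
    {f : DecSeq n | f.1 (d + 1) = 0}.Finite := by
  refine Set.Finite.of_injOn (f := fun (f : DecSeq n) (i : Fin (d + 1)) => f.1 i)
    (t := Set.Iic fun _ => n) ?_ ?_ (Set.finite_Iic _)
  · intro f _ i
    exact (f.2.2.1 0 i (Nat.zero_le _)).trans f.2.1.le
  · intro f hf g hg hfg
    refine Subtype.ext (funext fun i => ?_)
    rcases lt_or_ge i (d + 1) with hi | hi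
    · exact congrFun hfg ⟨i, hi⟩
    · have h1 := f.2.2.1 _ _ hi
      have h2 := g.2.2.1 _ _ hi
      rw [Set.mem_ofPred_eq] at hf hg
      omega

lemma summable_chainProd (hw : ∀ i m, Z ^ m ∣ w i m) (hw0 : ∀ i, w i 0 = 1) (n : ℕ) :
    Summable fun f : DecSeq n => chainProd w f.seq := by
  refine Pi.summable.mpr fun d => summable_of_hasFiniteSupport ?_
  refine (finite_setOf_decSeq_eq_zero n (d 0)).subset fun f hf => ?_
  by_contra h
  refine hf ?_
  obtain ⟨N, hN⟩ := f.2.2.2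
  refine MvPowerSeries.X_pow_dvd_iff.mp (Z_pow_sum_dvd_chainProd hw hw0 hN (d 0 + 1)) d ?_
  have : ∑ i ∈ Finset.range (d 0 + 1), 1 ≤ ∑ i ∈ Finset.range (d 0 + 1), f.1 (i + 1) := by
    refine Finset.sum_le_sum fun i hi => ?_
    have := f.2.2.1 (i + 1) (d 0 + 1) (Finset.mem_range.mp hi)
    rw [Set.mem_ofPred_eq] at h
    omega
  simpa using this

/-- A decreasing sequence starting at `n` is an entry `m ≤ n` followed by a decreasing sequence
starting at `m`. -/
def decSeqEquiv (n : ℕ) : (Σ m : Fin (n + 1), DecSeq m) ≃ DecSeq n where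
  toFun p := ⟨fun i => Nat.casesOn i n p.2.1, rfl, by
    have h0 : p.2.1 0 ≤ n := p.2.2.1.le.trans (Nat.lt_succ_iff.mp p.1.2)
    rintro (_ | i) (_ | j) hij
    · exact le_rfl
    · exact (p.2.2.2.1 0 j (Nat.zero_le j)).trans h0
    · omega
    · exact p.2.2.2.1 i j (by omega), by
    obtain ⟨N, hN⟩ := p.2.2.2.2
    refine ⟨N + 1, ?_⟩
    rintro (_ | i) hi
    · omega
    · exact hN i (by omega)⟩
  invFun f := ⟨⟨f.1 1, Nat.lt_succ_iff.mpr ((f.2.2.1 0 1 zero_le_one).trans f.2.1.le)⟩,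
    ⟨fun i => f.1 (i + 1), rfl, fun i j hij => f.2.2.1 _ _ (by omega), by
      obtain ⟨N, hN⟩ := f.2.2.2
      exact ⟨N, fun i hi => hN _ (by omega)⟩⟩⟩
  left_inv := by
    rintro ⟨⟨m, hm⟩, ⟨g, hg0, hg⟩⟩
    dsimp only at hg0
    subst hg0
    rfl
  right_inv f := by
    refine Subtype.ext (funext ?_)
    rintro (_ | i)
    · exact f.2.1.symm
    · rfl

lemma chainProd_decSeqEquiv (hw0 : ∀ i, w i 0 = 1) (n : ℕ) (p : Σ m : Fin (n + 1), DecSeq m) :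
    chainProd w (decSeqEquiv n p).seq =
      w 0 p.1 * gbinom n p.1 * chainProd (fun i => w (i + 1)) p.2.seq := by
  obtain ⟨N, hN⟩ := (decSeqEquiv n p).2.2.2
  have h0 : (decSeqEquiv n p).seq 0 = n := rfl
  have h1 : (decSeqEquiv n p).seq 1 = p.1 := p.2.2.1
  have h2 : (fun i => (decSeqEquiv n p).seq (i + 1)) = p.2.seq := rfl
  rw [chainProd_eq_mul_shift (f := (decSeqEquiv n p).seq) hw0 hN, h0, h1, h2]

lemma summable_mul_chainProd (hw : ∀ i m, Z ^ m ∣ w i m) (hw0 : ∀ i, w i 0 = 1) (a : R2) (n : ℕ) :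
    Summable fun f : DecSeq n => a * chainProd w f.seq :=
  (summable_chainProd hw hw0 n).mul_left a

lemma tsum_mul_chainProd (hw : ∀ i m, Z ^ m ∣ w i m) (hw0 : ∀ i, w i 0 = 1) (a : R2) (n : ℕ) :
    ∑' f : DecSeq n, a * chainProd w f.seq = a * chainSum w n :=
  (summable_chainProd hw hw0 n).tsum_mul_left a

lemma tsum_decSeq_eq_sum {n : ℕ} {G : (Σ m : Fin (n + 1), DecSeq m) → R2}
    (hfiber : ∀ m, Summable fun f => G ⟨m, f⟩) (hG : Summable G) :
    ∑' p, G p = ∑ m : Fin (n + 1), ∑' f : DecSeq m, G ⟨m, f⟩ :=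
  (hG.tsum_sigma' hfiber).trans (tsum_fintype _)

lemma summable_chainProd_sigma (hw : ∀ i m, Z ^ m ∣ w i m) (hw0 : ∀ i, w i 0 = 1) (n : ℕ) :
    Summable fun p : Σ m : Fin (n + 1), DecSeq m =>
      w 0 p.1 * gbinom n p.1 * chainProd (fun i => w (i + 1)) p.2.seq :=
  ((decSeqEquiv n).summable_iff.mpr (summable_chainProd hw hw0 n)).congr
    (chainProd_decSeqEquiv hw0 n)

lemma chainSum_eq_sum (hw : ∀ i m, Z ^ m ∣ w i m) (hw0 : ∀ i, w i 0 = 1) (n : ℕ) :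
    chainSum w n = ∑ m ∈ Finset.range (n + 1),
      w 0 m * gbinom n m * chainSum (fun i => w (i + 1)) m := by
  have hfiber (m : Fin (n + 1)) := summable_mul_chainProd (fun i => hw (i + 1))
    (fun i => hw0 (i + 1)) (w 0 m * gbinom n m) m
  rw [chainSum, ← (decSeqEquiv n).tsum_eq, tsum_congr (chainProd_decSeqEquiv hw0 n),
    tsum_decSeq_eq_sum hfiber (summable_chainProd_sigma hw hw0 n), Finset.sum_range]
  exact Finset.sum_congr rfl fun m _ =>
    tsum_mul_chainProd (fun i => hw (i + 1)) (fun i => hw0 (i + 1))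
      (w 0 m * gbinom n m) m

lemma chainSum_zero (hw0 : ∀ i, w i 0 = 1) : chainSum w 0 = 1 := by
  have hz (f : DecSeq 0) (i : ℕ) : f.seq i = 0 :=
    Nat.le_zero.mp ((f.2.2.1 0 i (Nat.zero_le i)).trans f.2.1.le)
  have hprod (f : DecSeq 0) : chainProd w f.seq = 1 := by
    rw [chainProd_eq_prod_range hw0 (N := 0) fun i _ => hz f i, Finset.prod_range_zero]
  let f₀ : DecSeq 0 := ⟨fun _ => 0, rfl, fun _ _ _ => le_rfl, 0, fun _ _ => rfl⟩
  rw [chainSum, tsum_eq_single f₀ fun f hf => (hf (Subtype.ext (funext (hz f)))).elim, hprod]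

/-- For weights `c` independent of the position, `chainSum` is the solution of the recursion
`H n = ∑ m ≤ n, c m * [n choose m] * H m` with `H 0 = 1`. -/
lemma chainSum_const_eq {c H : ℕ → R2} (hc : ∀ m, Z ^ m ∣ c m) (hc0 : c 0 = 1) (hH0 : H 0 = 1)
    (hH : ∀ n, H n = ∑ m ∈ Finset.range (n + 1), c m * gbinom n m * H m) (n : ℕ) :
    chainSum (fun _ => c) n = H n :=
  eq_of_gbinom_recursion hc ((chainSum_zero fun _ => hc0).trans hH0.symm)
    (chainSum_eq_sum (fun _ => hc) fun _ => hc0) hH n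

lemma chainSum_first_kind (n : ℕ) :
    chainSum (fun _ m => Z ^ m * Q ^ (m ^ 2)) n = (poch (Z * Q) n)⁻¹ :=
  chainSum_const_eq (H := fun n => (poch (Z * Q) n)⁻¹) (fun m => Dvd.intro _ rfl) (by simp)
    (by simp [poch_zero]) (fun n => (sum_gbinom_mul_inv_poch n Z).symm) n

lemma chainSum_second_kind (n : ℕ) :
    chainSum (fun _ m => Z ^ m * Q ^ (m ^ 2 + m)) n = (poch (Z * Q * Q) n)⁻¹ := by
  refine chainSum_const_eq (H := fun n => (poch (Z * Q * Q) n)⁻¹) (fun m => Dvd.intro _ rfl)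
    (by simp) (by simp [poch_zero]) (fun n => ?_) n
  rw [← sum_gbinom_mul_inv_poch n (Z * Q)]
  exact Finset.sum_congr rfl fun m _ => by ring

lemma one_sub_mul_inv_poch (n : ℕ) :
    (1 - Z * Q ^ (n + 1)) * (poch (Z * Q) (n + 1))⁻¹ = (poch (Z * Q) n)⁻¹ := by
  have ha : MvPowerSeries.constantCoeff (Z * Q) = 0 := by simp
  refine (isUnit_poch ha n).mul_left_cancel ?_
  rw [poch_mul_inv ha]
  linear_combination poch_mul_inv ha (n + 1) - (poch (Z * Q) (n + 1))⁻¹ * poch_succ (Z * Q) n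

lemma one_sub_mul_inv_poch' (n : ℕ) :
    (1 - Z * Q) * (poch (Z * Q) (n + 1))⁻¹ = (poch (Z * Q * Q) n)⁻¹ := by
  have ha : MvPowerSeries.constantCoeff (Z * Q) = 0 := by simp
  have hb : MvPowerSeries.constantCoeff (Z * Q * Q) = 0 := by simp
  refine (isUnit_poch hb n).mul_left_cancel ?_
  rw [poch_mul_inv hb]
  linear_combination poch_mul_inv ha (n + 1) - (poch (Z * Q) (n + 1))⁻¹ * poch_succ' (Z * Q) n

/-- The sum in which the first `s` factors are of the first kind and all others of the second. -/
lemma chainSum_mixed (s n : ℕ) :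
    chainSum (fun i m => if i < s then Z ^ m * Q ^ (m ^ 2) else Z ^ m * Q ^ (m ^ 2 + m)) n
      = (1 - Z * Q ^ (n + 1) - Z ^ (s + 1) * Q ^ (s + 1) * (1 - Q ^ n)) *
          (poch (Z * Q) (n + 1))⁻¹ := by
  induction s generalizing n with
  | zero =>
    simp only [Nat.not_lt_zero, if_false]
    rw [chainSum_second_kind, ← one_sub_mul_inv_poch']
    ring
  | succ s ih =>
    rw [chainSum_eq_sum (fun i m => by split_ifs <;> exact Dvd.intro _ rfl) (by simp)]
    simp only [Nat.zero_lt_succ, if_true, Nat.add_lt_add_iff_right, ih]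
    rw [sub_mul (1 - Z * Q ^ (n + 1)), one_sub_mul_inv_poch, ← sum_gbinom_mul_inv_poch,
      show Z ^ (s + 1 + 1) * Q ^ (s + 1 + 1) * (1 - Q ^ n) * (poch (Z * Q) (n + 1))⁻¹ =
        Z ^ (s + 1) * Q ^ (s + 1) * (Z * Q * ((1 - Q ^ n) * (poch (Z * Q) (n + 1))⁻¹)) by ring,
      ← sum_gbinom_mul_one_sub_mul_inv_poch, Finset.mul_sum, ← Finset.sum_sub_distrib]
    refine Finset.sum_congr rfl fun m _ => ?_
    rw [← one_sub_mul_inv_poch m]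
    ring

end ChainSum

/-- Theorem `eqn:truncinfiniteAG`: for every `t ∈ ℤ_{>0}`,
`∑_{n₀ ≥ n₁ ≥ n₂ ≥ ⋯ ≥ 0} ∏_{1 ≤ i < t} z^{n_i} q^{n_i²} [n_{i−1} choose n_i]_q
   · ∏_{j ≥ t} z^{n_j} q^{n_j²+n_j} [n_{j−1} choose n_j]_q
 = (1 − zq^{n₀+1} − z^t q^t (1 − q^{n₀})) / (zq;q)_{n₀+1}`,
together with the `t = ∞` case, where every factor is of the first kind and the sum equals
`(1 − zq^{n₀+1})/(zq;q)_{n₀+1} = 1/(zq;q)_{n₀}`. -/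
theorem statement3 (n₀ : ℕ) :
    (∀ t : ℕ, 1 ≤ t →
      (∑' f : DecSeq n₀, ∏' i : ℕ,
        ((if i + 1 < t then Z ^ (f.1 (i + 1)) * Q ^ ((f.1 (i + 1)) ^ 2)
          else Z ^ (f.1 (i + 1)) * Q ^ ((f.1 (i + 1)) ^ 2 + f.1 (i + 1))) *
          gbinom (f.1 i) (f.1 (i + 1))))
        = (1 - Z * Q ^ (n₀ + 1) - Z ^ t * Q ^ t * (1 - Q ^ n₀)) *
            (poch (Z * Q) (n₀ + 1))⁻¹) ∧
    ((∑' f : DecSeq n₀, ∏' i : ℕ,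
        (Z ^ (f.1 (i + 1)) * Q ^ ((f.1 (i + 1)) ^ 2) * gbinom (f.1 i) (f.1 (i + 1))))
        = (1 - Z * Q ^ (n₀ + 1)) * (poch (Z * Q) (n₀ + 1))⁻¹ ∧
      (1 - Z * Q ^ (n₀ + 1)) * (poch (Z * Q) (n₀ + 1))⁻¹ = (poch (Z * Q) n₀)⁻¹) := by
  refine ⟨fun t ht => ?_, ?_, one_sub_mul_inv_poch n₀⟩
  · obtain ⟨s, rfl⟩ := Nat.exists_eq_add_of_le' ht
    rw [← chainSum_mixed]
    simp only [Nat.add_lt_add_iff_right]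
    rfl
  · rw [one_sub_mul_inv_poch]
    exact chainSum_first_kind n₀
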